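/- Let D ∈ M_{m×a}(ℤ) describe pure binomials f_j = ∏_{i=1}^m x_i^{D_{ij}} − λ_j (λ_j ∈ K^×) in the torus (𝔾_m)^m over an algebraically closed field K of characteristic p > 0, and suppose their common vanishing locus is nonempty of codimension k. Then the common vanishing locus V(f_1,…,f_a) is smooth (as a scheme) if and only if the matrix D reduced modulo p has rank k over 𝔽_p. -/

import Mathlib

theorem Int.cast_natAbs_eq_zero_iff {R : Type*} [Ring R] (z : ℤ) :
    (z.natAbs : R) = 0 ↔ (z : R) = 0 := by
  obtain ⟨n, rfl | rfl⟩ := z.eq_nat_or_neg <;> simp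

theorem add_pow_of_sq_eq_zero {R : Type*} [CommRing R] (x : R) {y : R} (hy : y ^ 2 = 0) (n : ℕ) :
    (x + y) ^ n = x ^ n + n * x ^ (n - 1) * y := by
  obtain ⟨k, hk⟩ := Polynomial.powAddExpansion x y n
  rw [hk, hy, mul_zero, add_zero]

open Module in
theorem Module.Basis.SmithNormalForm.span_range_bN {R M ι : Type*} [CommRing R] [AddCommGroup M]
    [Module R M] {N : Submodule R M} {n : ℕ} (s : Basis.SmithNormalForm N ι n) :
    Submodule.span R (Set.range fun i ↦ (s.bN i : M)) = N := by
  have := congrArg (Submodule.map N.subtype) s.bN.span_eq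
  rwa [Submodule.map_span, ← Set.range_comp, Submodule.map_subtype_top] at this

theorem Module.Basis.SmithNormalForm.le_ker_iff {R M M' ι : Type*} [CommRing R] [AddCommGroup M]
    [Module R M] [AddCommGroup M'] [Module R M'] {N : Submodule R M} {n : ℕ}
    (s : Basis.SmithNormalForm N ι n) (φ : M →ₗ[R] M') :
    N ≤ LinearMap.ker φ ↔ ∀ i, s.a i • φ (s.bM (s.f i)) = 0 := by
  conv_lhs => lhs; rw [← s.span_range_bN]
  simp [Submodule.span_le, Set.range_subset_iff, s.snf]

theorem Module.Basis.SmithNormalForm.a_ne_zero {R M ι : Type*} [CommRing R] [Nontrivial R]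
    [AddCommGroup M] [Module R M] {N : Submodule R M} {n : ℕ}
    (s : Basis.SmithNormalForm N ι n) (i : Fin n) : s.a i ≠ 0 :=
  fun h ↦ s.bN.ne_zero i (by ext; simp [s.snf, h])

theorem exists_pow_eq_one_lift {R : Type*} [CommRing R] {J : Ideal R} (hJ : J ^ 2 = ⊥) {n : ℕ}
    (hn : IsUnit (n : R)) {u : R ⧸ J} (hu : u ^ n = 1) :
    ∃ w : R, w ^ n = 1 ∧ Ideal.Quotient.mk J w = u := by
  obtain ⟨w, rfl⟩ := Ideal.Quotient.mk_surjective u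
  obtain ⟨c, hc⟩ := hn.exists_left_inv
  have hε : w ^ n - 1 ∈ J := by
    rw [← Ideal.Quotient.eq_zero_iff_mem]
    simp [hu]
  have hsq (y : R) : (y * (w ^ n - 1)) ^ 2 = 0 := by
    rw [← Ideal.mem_bot, ← hJ]
    exact Ideal.pow_mem_pow (J.mul_mem_left y hε) 2
  refine ⟨w * (1 + -c * (w ^ n - 1)), ?_, ?_⟩
  · rw [mul_pow, add_pow_of_sq_eq_zero 1 (hsq _), one_pow, one_pow, mul_one]
    linear_combination (-1 : R) * hsq 1 - w ^ n * (w ^ n - 1) * hc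
  · rw [map_mul, map_add, map_mul, Ideal.Quotient.eq_zero_iff_mem.2 hε]
    simp

open Module in
theorem AddMonoidAlgebra.formallySmooth_quotient_of_smithNormalForm {K V ι : Type*} [Field K]
    [AddCommGroup V] [Fintype ι] {L : Submodule ℤ V} {n : ℕ}
    (s : Basis.SmithNormalForm L ι n) (ha : ∀ i, (s.a i : K) ≠ 0) :
    Algebra.FormallySmooth K (AddMonoidAlgebra K (V ⧸ L)) := by
  refine Algebra.FormallySmooth.of_comp_surjective fun R _ _ J hJ g ↦ ?_
  let t (v : V) : Multiplicative (V ⧸ L) := .ofAdd (L.mkQ v)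
  let χ : Multiplicative (V ⧸ L) →* (R ⧸ J) := (AddMonoidAlgebra.lift K (R ⧸ J) (V ⧸ L)).symm g
  have key (j : ι) : ∃ w : Rˣ, Ideal.Quotient.mk J w = χ (t (s.bM j)) ∧
      ∀ i, s.f i = j → w ^ (s.a i) = 1 := by
    by_cases hj : j ∈ Set.range s.f
    · obtain ⟨i, rfl⟩ := hj
      have ht : t (s.bM (s.f i)) ^ (s.a i) = 1 := by
        change Multiplicative.ofAdd (s.a i • L.mkQ (s.bM (s.f i))) = 1
        rw [← map_smul, ← s.snf]
        simp
      have ht' : t (s.bM (s.f i)) ^ (s.a i).natAbs = 1 := by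
        rwa [pow_natAbs_eq_one]
      have hN : ((s.a i).natAbs : K) ≠ 0 := (Int.cast_natAbs_eq_zero_iff _).not.2 (ha i)
      have hN0 : (s.a i).natAbs ≠ 0 := by
        rintro h
        simp [h] at hN
      have hu : IsUnit ((s.a i).natAbs : R) := by
        rw [← map_natCast (algebraMap K R)]
        exact (isUnit_iff_ne_zero.2 hN).map _
      obtain ⟨w, hw, hwu⟩ := exists_pow_eq_one_lift (u := χ (t (s.bM (s.f i)))) hJ hu
        (by rw [← map_pow, ht', map_one])
      refine ⟨.ofPowEqOne w _ hw hN0, hwu, fun i' hi' ↦ ?_⟩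
      obtain rfl := s.f.injective hi'
      rw [← pow_natAbs_eq_one]
      ext
      simp
    · obtain ⟨w, hw⟩ := Ideal.Quotient.mk_surjective (χ (t (s.bM j)))
      have hunit : IsUnit (Ideal.Quotient.mk J w) := by
        rw [hw]
        exact (Group.isUnit _).map χ
      obtain ⟨w, rfl⟩ := (IsNilpotent.isUnit_quotient_mk_iff ⟨2, hJ⟩).1 hunit
      exact ⟨w, hw, fun i hi ↦ (hj ⟨i, hi⟩).elim⟩
  choose w hw hwa using key
  let ψ : V →ₗ[ℤ] Additive Rˣ := s.bM.constr ℤ fun j ↦ Additive.ofMul (w j)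
  have hψL : L ≤ LinearMap.ker ψ := by
    rw [s.le_ker_iff]
    intro i
    rw [Basis.constr_basis]
    exact congrArg Additive.ofMul (hwa _ i rfl)
  let Ψ : V ⧸ L →ₗ[ℤ] Additive Rˣ := L.liftQ ψ hψL
  refine ⟨AddMonoidAlgebra.lift K R (V ⧸ L)
    ((Units.coeHom R).comp Ψ.toAddMonoidHom.toMultiplicativeLeft), ?_⟩
  have hΨ : (Units.map (Ideal.Quotient.mk J : R →* R ⧸ J)).toAdditive.toIntLinearMap ∘ₗ ψ =
      (MonoidHom.toAdditiveRight χ.toHomUnits).toIntLinearMap ∘ₗ L.mkQ := by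
    refine s.bM.ext fun j ↦ ?_
    apply Additive.toMul.injective
    ext
    change Ideal.Quotient.mk J (Additive.toMul (ψ (s.bM j)) : Rˣ) = χ (t (s.bM j))
    rw [Basis.constr_basis]
    exact hw j
  apply (AddMonoidAlgebra.lift K (R ⧸ J) (V ⧸ L)).symm.injective
  refine MonoidHom.ext fun v ↦ ?_
  induction v with | ofAdd v
  obtain ⟨v, rfl⟩ := L.mkQ_surjective v
  have := congrArg (fun u ↦ ((Additive.toMul u : (R ⧸ J)ˣ) : R ⧸ J)) (LinearMap.congr_fun hΨ v)
  simpa [Ψ, χ] using this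

open Module in
theorem AddMonoidAlgebra.pow_natAbs_eq_one_of_formallySmooth_quotient {K V ι B : Type*} [Field K]
    [AddCommGroup V] {L : Submodule ℤ V} {n : ℕ} (s : Basis.SmithNormalForm L ι n)
    [Algebra.FormallySmooth K (AddMonoidAlgebra K (V ⧸ L))] [CommRing B] [Algebra K B]
    {i : Fin n} (ha : (s.a i : K) = 0) {x : B} (hx : (x ^ (s.a i).natAbs - 1) ^ 2 = 0) :
    x ^ (s.a i).natAbs = 1 := by
  classical
  set N := (s.a i).natAbs with hN
  have hN0 : N ≠ 0 := Int.natAbs_ne_zero.2 (s.a_ne_zero i)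
  have hNK : (N : K) = 0 := (Int.cast_natAbs_eq_zero_iff _).2 ha
  let J : Ideal B := Ideal.span {x ^ N - 1}
  have hJ : J ^ 2 = ⊥ := by
    rw [Ideal.span_singleton_pow, hx, Ideal.span_singleton_eq_bot]
  have hxJ : Ideal.Quotient.mk J x ^ N = 1 := by
    rw [← map_pow, ← map_one (Ideal.Quotient.mk J), Ideal.Quotient.eq]
    exact Ideal.mem_span_singleton_self _
  let u : (B ⧸ J)ˣ := .ofPowEqOne _ N hxJ hN0
  have hu : u ^ s.a i = 1 := by
    rw [← pow_natAbs_eq_one]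
    ext
    simpa [u] using hxJ
  let ψ : V →ₗ[ℤ] Additive (B ⧸ J)ˣ :=
    s.bM.constr ℤ fun j ↦ if j = s.f i then Additive.ofMul u else 0
  have hψL : L ≤ LinearMap.ker ψ := by
    rw [s.le_ker_iff]
    intro j
    rw [Basis.constr_basis]
    split_ifs with h
    · obtain rfl := s.f.injective h
      exact congrArg Additive.ofMul hu
    · simp
  let Ψ : V ⧸ L →ₗ[ℤ] Additive (B ⧸ J)ˣ := L.liftQ ψ hψL
  obtain ⟨θ, hθ⟩ := Algebra.FormallySmooth.exists_lift J ⟨2, hJ⟩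
    (AddMonoidAlgebra.lift K (B ⧸ J) (V ⧸ L)
      ((Units.coeHom _).comp Ψ.toAddMonoidHom.toMultiplicativeLeft))
  let g : V ⧸ L := L.mkQ (s.bM (s.f i))
  have hg : N • g = 0 := by
    rw [natAbs_nsmul_eq_zero, ← map_smul, ← s.snf]
    simp
  let y : B := θ (.single g 1)
  have hyN : y ^ N = 1 := by
    rw [← map_pow, AddMonoidAlgebra.single_pow, hg, one_pow, ← AddMonoidAlgebra.one_def, map_one]
  have hyx : Ideal.Quotient.mk J y = Ideal.Quotient.mk J x := by
    have h := AlgHom.congr_fun hθ (.single g 1)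
    rw [AddMonoidAlgebra.lift_single, one_smul] at h
    refine h.trans ?_
    change ((Additive.toMul (ψ (s.bM (s.f i))) : (B ⧸ J)ˣ) : B ⧸ J) = _
    rw [Basis.constr_basis, if_pos rfl]
    rfl
  rw [Ideal.Quotient.eq, Ideal.mem_span_singleton] at hyx
  obtain ⟨c, hc⟩ := hyx
  have hNB : (N : B) = 0 := by simpa using congrArg (algebraMap K B) hNK
  rw [← hyN, eq_add_of_sub_eq' hc, add_pow_of_sq_eq_zero x (by rw [mul_pow, hx, zero_mul]), hNB]
  simp

open Module Polynomial in
theorem AddMonoidAlgebra.a_ne_zero_of_formallySmooth_quotient {K V ι : Type*} [Field K]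
    [AddCommGroup V] {L : Submodule ℤ V} {n : ℕ} (s : Basis.SmithNormalForm L ι n)
    [Algebra.FormallySmooth K (AddMonoidAlgebra K (V ⧸ L))] (i : Fin n) : (s.a i : K) ≠ 0 := by
  intro ha
  let P : K[X] := X ^ (s.a i).natAbs - 1
  have hdvd : P ^ 2 ∣ P := by
    rw [← Ideal.mem_span_singleton, ← Ideal.Quotient.eq_zero_iff_mem, map_sub, map_pow, map_one,
      sub_eq_zero]
    apply pow_natAbs_eq_one_of_formallySmooth_quotient s ha
    rw [← map_pow, ← map_one (Ideal.Quotient.mk _), ← map_sub, ← map_pow]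
    exact Ideal.Quotient.eq_zero_iff_mem.2 (Ideal.mem_span_singleton_self _)
  have hN0 : (s.a i).natAbs ≠ 0 := Int.natAbs_ne_zero.2 (s.a_ne_zero i)
  have hdeg : P.natDegree = (s.a i).natAbs := natDegree_X_pow_sub_C (r := (1 : K))
  have hP0 : P ≠ 0 := fun h ↦ hN0 (by rw [← hdeg, h, natDegree_zero])
  have := natDegree_le_of_dvd hdvd hP0
  rw [natDegree_pow, hdeg] at this
  omega

theorem ringKrullDim_le_of_isIntegral {R S : Type*} [CommRing R] [CommRing S]
    (f : R →+* S) (hf : f.IsIntegral) : ringKrullDim S ≤ ringKrullDim R := by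
  algebraize [f]
  refine Order.krullDim_le_of_strictMono (PrimeSpectrum.comap (algebraMap R S)) fun I J h ↦ ?_
  exact Ideal.IsIntegral.comap_lt_comap (R := R) (I := I.asIdeal) (J := J.asIdeal) h

theorem IsLocalization.ringKrullDim_le {R : Type*} [CommRing R] (M : Submonoid R)
    (S : Type*) [CommRing S] [Algebra R S] [IsLocalization M S] :
    ringKrullDim S ≤ ringKrullDim R := by
  refine Order.krullDim_le_of_strictMono (PrimeSpectrum.comap (algebraMap R S)) fun I J h ↦ ?_
  refine lt_of_le_of_ne (Ideal.comap_mono (f := algebraMap R S) h.le) fun e ↦ h.ne ?_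
  exact PrimeSpectrum.localization_comap_injective S M e

open LaurentPolynomial Polynomial in
theorem LaurentPolynomial.ringKrullDim_of_isNoetherianRing (R : Type*) [CommRing R]
    [IsNoetherianRing R] : ringKrullDim R[T;T⁻¹] = ringKrullDim R + 1 := by
  apply le_antisymm
  · rw [← Polynomial.ringKrullDim_of_isNoetherianRing]
    exact IsLocalization.ringKrullDim_le (.powers (X : R[X])) _
  · let g : R[T;T⁻¹] →+* R := eval₂ (RingHom.id R) 1
    have hnz : algebraMap R[X] R[T;T⁻¹] (X - 1) ∈ nonZeroDivisors R[T;T⁻¹] := by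
      refine IsLocalization.map_nonZeroDivisors_le (.powers (X : R[X])) _ ⟨_, ?_, rfl⟩
      have := (Polynomial.monic_X_sub_C (1 : R)).mem_nonZeroDivisors
      simpa using this
    refine le_trans ?_ (ringKrullDim_quotient_succ_le_of_nonZeroDivisor hnz)
    gcongr
    refine ringKrullDim_le_of_surjective (Ideal.Quotient.lift _ g ?_) ?_
    · suffices Ideal.span {algebraMap R[X] R[T;T⁻¹] (X - 1)} ≤ RingHom.ker g from
        fun a ha ↦ this ha
      rw [Ideal.span_singleton_le_iff_mem, RingHom.mem_ker,
        LaurentPolynomial.algebraMap_eq_toLaurent]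
      simp [g, -map_sub, eval₂_toLaurent]
    · apply Ideal.Quotient.lift_surjective_of_surjective
      intro r
      exact ⟨C r, by simp [g]⟩

theorem AddMonoidAlgebra.ringKrullDim_fin_int (d : ℕ) (R : Type*) [CommRing R]
    [IsNoetherianRing R] : ringKrullDim (AddMonoidAlgebra R (Fin d → ℤ)) = ringKrullDim R + d := by
  induction d generalizing R with
  | zero =>
    simpa using ringKrullDim_eq_of_ringEquiv
      (AddMonoidAlgebra.uniqueAlgEquiv R (A := R) (M := Fin 0 → ℤ)).toRingEquiv
  | succ d ih =>
    have : IsNoetherianRing (LaurentPolynomial R) :=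
      IsLocalization.isNoetherianRing (.powers (Polynomial.X : Polynomial R)) _ inferInstance
    let e : (Fin (d + 1) → ℤ) ≃+ (Fin d → ℤ) × ℤ :=
      { (Fin.consEquiv (fun _ : Fin (d+1) ↦ ℤ)).symm.trans (Equiv.prodComm _ _) with
        map_add' := fun _ _ ↦ rfl }
    rw [ringKrullDim_eq_of_ringEquiv ((AddMonoidAlgebra.domCongr R R e).toRingEquiv.trans
      AddMonoidAlgebra.curryRingEquiv)]
    have := ih (LaurentPolynomial R)
    rw [LaurentPolynomial.ringKrullDim_of_isNoetherianRing] at this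
    refine this.trans ?_
    push_cast
    rw [add_assoc, add_comm (1 : WithBot ℕ∞)]

theorem AddMonoidAlgebra.mapDomainRingHom_isIntegral {R F G : Type*} [CommRing R] [AddCommGroup F]
    [AddCommGroup G] (φ : F →+ G) (h : ∀ g, ∃ N : ℕ, 0 < N ∧ N • g ∈ φ.range) :
    (AddMonoidAlgebra.mapDomainRingHom R φ).IsIntegral := by
  intro x
  induction x using AddMonoidAlgebra.induction_linear with
  | zero => exact RingHom.isIntegralElem_zero _
  | add x y hx hy => exact hx.add _ hy
  | single g r =>
    obtain ⟨N, hN, v, hv⟩ := h g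
    refine @IsIntegral.of_pow _ _ _ _ (AddMonoidAlgebra.mapDomainRingHom R φ).toAlgebra _ _ hN ?_
    change RingHom.IsIntegralElem (AddMonoidAlgebra.mapDomainRingHom R φ) _
    rw [AddMonoidAlgebra.single_pow, ← hv]
    simpa using (AddMonoidAlgebra.mapDomainRingHom R φ).isIntegralElem_map
      (x := AddMonoidAlgebra.single v (r ^ N))

open Module in
theorem AddMonoidAlgebra.ringKrullDim_quotient_of_smithNormalForm {R V ι : Type*} [CommRing R]
    [IsNoetherianRing R] [AddCommGroup V] [Fintype ι] {L : Submodule ℤ V} {n : ℕ}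
    (s : Basis.SmithNormalForm L ι n) :
    ringKrullDim (AddMonoidAlgebra R (V ⧸ L)) = ringKrullDim R + (Fintype.card ι - n : ℕ) := by
  classical
  have hcard : Fintype.card {j // j ∉ Set.range s.f} = Fintype.card ι - n := by
    rw [Fintype.card_subtype_compl]
    congr 1
    exact (Fintype.card_congr (Equiv.ofInjective s.f s.f.injective).symm).trans (Fintype.card_fin n)
  let e : Fin (Fintype.card ι - n) ≃ {j // j ∉ Set.range s.f} :=
    (finCongr hcard.symm).trans (Fintype.equivFin _).symm
  let incl : (Fin (Fintype.card ι - n) → ℤ) →ₗ[ℤ] V ⧸ L :=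
    L.mkQ ∘ₗ Fintype.linearCombination ℤ (fun k ↦ s.bM (e k))
  let proj : V ⧸ L →ₗ[ℤ] (Fin (Fintype.card ι - n) → ℤ) :=
    L.liftQ (LinearMap.pi fun k ↦ s.bM.coord (e k)) fun x hx ↦ by
      ext k
      exact s.repr_eq_zero_of_notMem_range ⟨x, hx⟩ (e k).2
  have hproj (v) : proj (incl v) = v := by
    ext k
    change s.bM.repr (Fintype.linearCombination ℤ (fun k ↦ s.bM (e k)) v) (e k) = v k
    simp [Fintype.linearCombination_apply, Finsupp.single_apply, Subtype.val_inj]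
  have htors (g : V ⧸ L) : ∃ N : ℕ, 0 < N ∧ N • g ∈ incl.toAddMonoidHom.range := by
    obtain ⟨v, rfl⟩ := L.mkQ_surjective g
    have hv : v ∈ Submodule.span ℤ (Set.range s.bM) := by simp [s.bM.span_eq]
    induction hv using Submodule.span_induction with
    | zero => exact ⟨1, one_pos, by simp [zero_mem]⟩
    | add x y _ _ hx hy =>
      obtain ⟨N, hN, hx⟩ := hx
      obtain ⟨M, hM, hy⟩ := hy
      refine ⟨N * M, Nat.mul_pos hN hM, ?_⟩
      rw [map_add, smul_add]
      refine add_mem ?_ ?_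
      · rw [mul_comm, mul_smul]
        exact nsmul_mem hx M
      · rw [mul_smul]
        exact nsmul_mem hy N
    | smul z x _ hx =>
      obtain ⟨N, hN, hx⟩ := hx
      refine ⟨N, hN, ?_⟩
      rw [map_smul, smul_comm]
      exact zsmul_mem hx z
    | mem x hx =>
      obtain ⟨j, rfl⟩ := hx
      by_cases hj : j ∈ Set.range s.f
      · obtain ⟨i, rfl⟩ := hj
        refine ⟨(s.a i).natAbs, Int.natAbs_pos.2 (s.a_ne_zero i), ?_⟩
        have h0 : (s.a i).natAbs • L.mkQ (s.bM (s.f i)) = 0 := by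
          rw [natAbs_nsmul_eq_zero, ← map_smul, ← s.snf]
          simp
        rw [h0]
        exact zero_mem _
      · refine ⟨1, one_pos, Pi.single (e.symm ⟨j, hj⟩) 1, ?_⟩
        simp [incl, Fintype.linearCombination_apply_single]
  rw [← AddMonoidAlgebra.ringKrullDim_fin_int]
  apply le_antisymm
  · exact ringKrullDim_le_of_isIntegral _ (mapDomainRingHom_isIntegral _ htors)
  · refine ringKrullDim_le_of_surjective (mapDomainRingHom R proj.toAddMonoidHom) ?_
    refine Function.LeftInverse.surjective (g := mapDomainRingHom R incl.toAddMonoidHom) fun x ↦ ?_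
    induction x using AddMonoidAlgebra.induction_linear with
    | zero => simp
    | add x y hx hy => simp only [map_add, hx, hy]
    | single g r => simp [hproj]

theorem Submodule.span_image_eq_of_span_eq {R S M N : Type*} [CommSemiring R] [Semiring S]
    [AddCommMonoid M] [AddCommMonoid N] [Module R M] [Module R N] [Module S N] [SMul R S]
    [IsScalarTower R S N] (φ : M →ₗ[R] N) {s t : Set M}
    (h : Submodule.span R s = Submodule.span R t) :
    Submodule.span S (Set.image φ s) = Submodule.span S (Set.image φ t) := by
  rw [← Submodule.span_span_of_tower R S (Set.image φ s),
    ← Submodule.span_span_of_tower R S (Set.image φ t),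
    ← Submodule.map_span, ← Submodule.map_span, h]

open Module in
theorem Matrix.rank_map_intCast_eq_iff {F ι κ : Type*} [Field F] [Fintype ι] [Fintype κ]
    (D : Matrix ι κ ℤ) {n : ℕ}
    (s : Basis.SmithNormalForm (Submodule.span ℤ (Set.range D.col)) ι n) :
    (D.map (Int.cast : ℤ → F)).rank = n ↔ ∀ i, (s.a i : F) ≠ 0 := by
  classical
  let φ : (ι → ℤ) →ₗ[ℤ] (ι → F) := (Algebra.linearMap ℤ F).compLeft ι
  let b (j : ι) : ι → F := φ (s.bM j)
  have hb : LinearIndependent F b := by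
    refine linearIndependent_of_top_le_span_of_card_eq_finrank ?_ (by simp)
    have : Submodule.span ℤ (Set.range s.bM) = Submodule.span ℤ (Set.range (Pi.basisFun ℤ ι)) := by
      rw [s.bM.span_eq, Basis.span_eq]
    have := Submodule.span_image_eq_of_span_eq (S := F) φ this
    rw [← Set.range_comp, ← Set.range_comp] at this
    change ⊤ ≤ Submodule.span F (Set.range (φ ∘ s.bM))
    rw [this, ← (Pi.basisFun F ι).span_eq]
    apply le_of_eq
    congr 2
    ext i j
    simp [φ, Pi.single_apply, apply_ite]
  have hrank : (D.map (Int.cast : ℤ → F)).rank =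
      (Set.range fun i ↦ (s.a i : F) • b (s.f i)).finrank F := by
    rw [Matrix.rank_eq_finrank_span_cols, Set.finrank]
    have := Submodule.span_image_eq_of_span_eq (S := F) φ s.span_range_bN.symm
    rw [← Set.range_comp, ← Set.range_comp] at this
    have h1 : (D.map (Int.cast : ℤ → F)).col = φ ∘ D.col := rfl
    have h2 : (fun i ↦ (s.a i : F) • b (s.f i)) = φ ∘ fun i ↦ (s.bN i : ι → ℤ) := by
      ext1 i
      simp [s.snf, b, Int.cast_smul_eq_zsmul, -zsmul_eq_mul]
    rw [h1, h2, this]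
  have hli : LinearIndependent F (fun i ↦ (s.a i : F) • b (s.f i)) ↔
      Fintype.card (Fin n) = (Set.range fun i ↦ (s.a i : F) • b (s.f i)).finrank F :=
    linearIndependent_iff_card_eq_finrank_span
  rw [Fintype.card_fin] at hli
  rw [hrank, eq_comm, ← hli]
  constructor
  · intro h i hi
    exact h.ne_zero i (by simp [hi])
  · intro h
    exact (hb.comp _ s.f.injective).units_smul (fun i ↦ Units.mk0 _ (h i))

theorem exists_algHom_of_finiteType (K A : Type*) [Field K] [IsAlgClosed K] [CommRing A]
    [Algebra K A] [Algebra.FiniteType K A] [Nontrivial A] : Nonempty (A →ₐ[K] K) := by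
  obtain ⟨M, hM⟩ := Ideal.exists_maximal A
  let _ := Ideal.Quotient.field M
  have := finite_of_finite_type_of_isJacobsonRing K (A ⧸ M)
  exact ⟨((AlgEquiv.ofBijective (Algebra.ofId K (A ⧸ M))
    IsAlgClosed.algebraMap_bijective_of_isIntegral).symm : (A ⧸ M) →ₐ[K] K).comp
    (Ideal.Quotient.mkₐ K M)⟩

theorem AddMonoidAlgebra.nonempty_algEquiv_of_ker_eq_span_binomial {K V κ B : Type*} [Field K]
    [IsAlgClosed K] [AddCommGroup V] [AddGroup.FG V] [CommRing B] [Algebra K B] [Nontrivial B]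
    (d : κ → V) (lam : κ → K) (q : AddMonoidAlgebra K V →ₐ[K] B) (hq : Function.Surjective q)
    (hker : RingHom.ker q =
      Ideal.span (Set.range fun j ↦ single (d j) (1 : K) - single 0 (lam j))) :
    Nonempty (B ≃ₐ[K] AddMonoidAlgebra K (V ⧸ Submodule.span ℤ (Set.range d))) := by
  have : AddMonoid.FG V := AddGroup.fg_iff_addMonoid_fg.1 inferInstance
  have : Algebra.FiniteType K B := .of_surjective q hq
  obtain ⟨pt⟩ := exists_algHom_of_finiteType K B
  have hrel (j : κ) : q (single (d j) 1) = algebraMap K _ (lam j) := by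
    rw [← q.commutes, ← sub_eq_zero, ← map_sub]
    change single (d j) 1 - single 0 (lam j) ∈ RingHom.ker q
    rw [hker]
    exact Ideal.subset_span ⟨j, rfl⟩
  let c : Multiplicative V →* Kˣ := ((lift K K V).symm (pt.comp q)).toHomUnits
  have hc (j : κ) : (c (.ofAdd (d j)) : K) = lam j := by
    change pt (q (single (d j) 1)) = lam j
    rw [hrel]
    simp
  let L := Submodule.span ℤ (Set.range d)
  let F : AddMonoidAlgebra K V →ₐ[K] AddMonoidAlgebra K (V ⧸ L) := lift K _ V
    { toFun v := single (L.mkQ v.toAdd) (c v : K)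
      map_one' := by simp [one_def]
      map_mul' v w := by simp [single_mul_single] }
  have hF (v : V) (r : K) : F (single v r) = single (L.mkQ v) (r * c (.ofAdd v)) := by
    simp [F]
  have hF_surj : Function.Surjective F := by
    intro x
    induction x using AddMonoidAlgebra.induction_linear with
    | zero => exact ⟨0, map_zero F⟩
    | add x y hx hy =>
      obtain ⟨x, rfl⟩ := hx
      obtain ⟨y, rfl⟩ := hy
      exact ⟨x + y, map_add F x y⟩
    | single g r =>
      obtain ⟨v, rfl⟩ := L.mkQ_surjective g
      exact ⟨single v (r * ((c (.ofAdd v))⁻¹ : Kˣ)), by rw [hF, Units.inv_mul_cancel_right]⟩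
  have hF_ker : RingHom.ker q ≤ RingHom.ker F := by
    rw [hker, Ideal.span_le]
    rintro _ ⟨j, rfl⟩
    have : L.mkQ (d j) = 0 := by
      rw [← LinearMap.mem_ker, Submodule.ker_mkQ]
      exact Submodule.subset_span ⟨j, rfl⟩
    simp only [SetLike.mem_coe, RingHom.mem_ker, map_sub, hF, this, hc]
    simp
  let ψ₀ : Multiplicative V →* Bˣ :=
    ((lift K _ V).symm q).toHomUnits * (Units.map (algebraMap K B).toMonoidHom).comp c⁻¹
  let ψ : V →ₗ[ℤ] Additive Bˣ := (MonoidHom.toAdditiveRight ψ₀).toIntLinearMap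
  have hψ (v : V) : ((Additive.toMul (ψ v) : Bˣ) : B) =
      q (single v 1) * algebraMap K B ((c (.ofAdd v))⁻¹ : Kˣ) := rfl
  have hψL : L ≤ LinearMap.ker ψ := by
    rw [Submodule.span_le]
    rintro _ ⟨j, rfl⟩
    rw [SetLike.mem_coe, LinearMap.mem_ker]
    apply Additive.toMul.injective
    ext
    rw [hψ, hrel, ← hc, ← map_mul]
    simp
  let Ψ : V ⧸ L →ₗ[ℤ] Additive Bˣ := L.liftQ ψ hψL
  let G : AddMonoidAlgebra K (V ⧸ L) →ₐ[K] B :=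
    lift K _ (V ⧸ L) ((Units.coeHom _).comp Ψ.toAddMonoidHom.toMultiplicativeLeft)
  have hG (v : V) (r : K) : G (single (L.mkQ v) r) =
      r • (q (single v 1) * algebraMap K B ((c (.ofAdd v))⁻¹ : Kˣ)) := by
    rw [← hψ]
    exact lift_single _ _ _
  have hGF : G.comp F = q := by
    apply (lift K _ V).symm.injective
    refine MonoidHom.ext fun v ↦ ?_
    induction v with | ofAdd v
    change G (F (single v 1)) = q (single v 1)
    rw [hF, hG, Algebra.smul_def, mul_left_comm, ← map_mul]
    simp
  have hGF' (x) : G (F x) = q x := AlgHom.congr_fun hGF x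
  refine ⟨(AlgEquiv.ofBijective G ⟨?_, fun y ↦ ?_⟩).symm⟩
  · rw [injective_iff_map_eq_zero]
    intro x hx
    obtain ⟨y, rfl⟩ := hF_surj x
    exact hF_ker (by rwa [RingHom.mem_ker, ← hGF'])
  · obtain ⟨x, rfl⟩ := hq y
    exact ⟨F x, hGF' x⟩

/-- Jacobian/rank criterion for smoothness of a binomial subscheme of the torus:
with `f_j = x^{D_{·j}} - λ_j` Laurent binomials over an algebraically closed field
of characteristic `p > 0`, and `V(f_1,…,f_a)` nonempty of codimension `k`
(i.e. the quotient ring is nontrivial of Krull dimension `m - k`), the scheme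
`V(f_1,…,f_a)` is smooth iff `D mod p` has rank `k` over `𝔽_p`. -/
theorem stmt3 {K : Type*} [Field K] [IsAlgClosed K] (p : ℕ) [CharP K p]
    (hp : p.Prime) (m a k : ℕ) (hk : k ≤ m)
    (D : Matrix (Fin m) (Fin a) ℤ) (lam : Fin a → K) (hlam : ∀ j, lam j ≠ 0)
    (I : Ideal (AddMonoidAlgebra K (Fin m → ℤ)))
    (hI : I = Ideal.span (Set.range fun j =>
        AddMonoidAlgebra.single (fun i => D i j) (1 : K)
          - AddMonoidAlgebra.single (0 : Fin m → ℤ) (lam j)))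
    (hne : Nontrivial (AddMonoidAlgebra K (Fin m → ℤ) ⧸ I))
    (hcodim : ringKrullDim (AddMonoidAlgebra K (Fin m → ℤ) ⧸ I) = (m - k : ℕ)) :
    Algebra.FormallySmooth K (AddMonoidAlgebra K (Fin m → ℤ) ⧸ I) ↔
      (D.map (Int.cast : ℤ → ZMod p)).rank = k := by
  have := Fact.mk hp
  obtain ⟨n, s⟩ := Submodule.smithNormalForm (Pi.basisFun ℤ (Fin m))
    (Submodule.span ℤ (Set.range D.col))
  obtain ⟨e⟩ := AddMonoidAlgebra.nonempty_algEquiv_of_ker_eq_span_binomial D.col lam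
    (Ideal.Quotient.mkₐ K I) (Ideal.Quotient.mkₐ_surjective K I)
    ((Ideal.Quotient.mkₐ_ker K I).trans hI)
  have hn : n ≤ m := by simpa using Fintype.card_le_of_embedding s.f
  have hdim := ringKrullDim_eq_of_ringEquiv e.toRingEquiv
  rw [hcodim, AddMonoidAlgebra.ringKrullDim_quotient_of_smithNormalForm s,
    ringKrullDim_eq_zero_of_field, zero_add, Fintype.card_fin, Nat.cast_inj] at hdim
  obtain rfl : n = k := by omega
  rw [Algebra.FormallySmooth.iff_of_equiv e, Matrix.rank_map_intCast_eq_iff D s]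
  have hcast (i : Fin n) : (s.a i : K) ≠ 0 ↔ (s.a i : ZMod p) ≠ 0 := by
    rw [Ne, CharP.intCast_eq_zero_iff K p, Ne, CharP.intCast_eq_zero_iff (ZMod p) p]
  simp_rw [← hcast]
  exact ⟨fun _ ↦ AddMonoidAlgebra.a_ne_zero_of_formallySmooth_quotient s,
    AddMonoidAlgebra.formallySmooth_quotient_of_smithNormalForm s⟩
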